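/- arXiv:1610.04420 — 4 statements merged into one kernel-verified Lean document; each statement's English description precedes it below -/
import Mathlib

section
/- (Lemma 1.) Let Ω be a measurable space, H a real Hilbert space, φ : Ω → H a measurable map Bochner-integrable with respect to two probability measures μ_S and μ_T on Ω, and define the cost c(x,y) = ‖φ(x) − φ(y)‖_H. Suppose that for hypotheses h, h' the associated loss function x ↦ ℓ(h(x), h'(x)) has the form x ↦ ⟨φ(x), g⟩_H for some element g ∈ H with ‖g‖_H ≤ 1. Then ε_T(h, h') ≤ ε_S(h, h') + W₁(μ_S, μ_T), where ε_S(h,h') = E_{x∼μ_S}[ℓ(h(x),h'(x))], ε_T(h,h') = E_{x∼μ_T}[ℓ(h(x),h'(x))], and W₁(μ_S,μ_T) = inf_{γ ∈ Π(μ_S,μ_T)} ∫_{Ω×Ω} c(x,y) dγ(x,y). -/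
open MeasureTheory
open scoped RealInnerProductSpace ENNReal

noncomputable section

/-- `Couplings μ ν` is the set of probability measures on `Ω × Ω` whose first marginal is `μ`
and whose second marginal is `ν`. -/
def Couplings {Ω : Type*} [MeasurableSpace Ω] (μ ν : Measure Ω) : Set (Measure (Ω × Ω)) :=
  {γ | IsProbabilityMeasure γ ∧ γ.map Prod.fst = μ ∧ γ.map Prod.snd = ν}

/-- The Wasserstein distance of order 1 with cost `c`:
`W₁(μ,ν) = inf_{γ ∈ Π(μ,ν)} ∫ c(x,y) dγ(x,y)`. -/
def W1 {Ω : Type*} [MeasurableSpace Ω] (c : Ω → Ω → ℝ) (μ ν : Measure Ω) : ℝ :=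
  (⨅ γ ∈ Couplings μ ν, ∫⁻ p, ENNReal.ofReal (c p.1 p.2) ∂γ).toReal

/-- The error of hypothesis `u` with respect to labeling `v` under measure `μ` for loss `ℓ`:
`ε_D(u,v) = E_{x∼μ_D}[ℓ(u(x),v(x))]`. -/
def err {Ω : Type*} [MeasurableSpace Ω] (μ : Measure Ω) (ℓ : ℝ → ℝ → ℝ)
    (u v : Ω → ℝ) : ℝ :=
  ∫ x, ℓ (u x) (v x) ∂μ

/-- Lemma 1: if the loss `x ↦ ℓ(h(x), h'(x))` has the form `x ↦ ⟪φ(x), g⟫` for some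
`g` in the unit ball of `H`, then `ε_T(h,h') ≤ ε_S(h,h') + W₁(μ_S, μ_T)` for the cost
`c(x,y) = ‖φ(x) - φ(y)‖`. -/
theorem target_err_le_source_err_add_W1
    {Ω H : Type*} [MeasurableSpace Ω]
    [NormedAddCommGroup H] [InnerProductSpace ℝ H] [CompleteSpace H]
    [MeasurableSpace H] [BorelSpace H]
    (μS μT : Measure Ω) [IsProbabilityMeasure μS] [IsProbabilityMeasure μT]
    (φ : Ω → H) (hφ : Measurable φ)
    (hφS : Integrable φ μS) (hφT : Integrable φ μT)
    (ℓ : ℝ → ℝ → ℝ) (h h' : Ω → ℝ)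
    (hrepr : ∃ g : H, ‖g‖ ≤ 1 ∧ ∀ x, ℓ (h x) (h' x) = ⟪φ x, g⟫) :
    err μT ℓ h h' ≤ err μS ℓ h h' + W1 (fun x y => ‖φ x - φ y‖) μS μT := by
  obtain ⟨g, hg, hr⟩ := hrepr
  have key : ∀ γ ∈ Couplings μS μT,
      Integrable (fun p : Ω × Ω => ‖φ p.1 - φ p.2‖) γ ∧
      err μT ℓ h h' - err μS ℓ h h' ≤ ∫ p, ‖φ p.1 - φ p.2‖ ∂γ := by
    rintro γ ⟨hγ, h1, h2⟩
    have i1 : Integrable (fun p : Ω × Ω => φ p.1) γ := by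
      have hS : Integrable φ (γ.map Prod.fst) := by rw [h1]; exact hφS
      exact hS.comp_measurable measurable_fst
    have i2 : Integrable (fun p : Ω × Ω => φ p.2) γ := by
      have hT : Integrable φ (γ.map Prod.snd) := by rw [h2]; exact hφT
      exact hT.comp_measurable measurable_snd
    have hn : Integrable (fun p : Ω × Ω => ‖φ p.1 - φ p.2‖) γ := (i1.sub i2).norm
    refine ⟨hn, ?_⟩
    have e1 : err μS ℓ h h' = ∫ p, ⟪φ p.1, g⟫ ∂γ := by
      unfold err
      simp only [hr]
      have hS : Integrable (fun x => ⟪φ x, g⟫) μS := hφS.inner_const g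
      rw [← h1] at hS ⊢
      exact integral_map measurable_fst.aemeasurable hS.aestronglyMeasurable
    have e2 : err μT ℓ h h' = ∫ p, ⟪φ p.2, g⟫ ∂γ := by
      unfold err
      simp only [hr]
      have hT : Integrable (fun x => ⟪φ x, g⟫) μT := hφT.inner_const g
      rw [← h2] at hT ⊢
      exact integral_map measurable_snd.aemeasurable hT.aestronglyMeasurable
    rw [e1, e2, ← integral_sub (i2.inner_const g) (i1.inner_const g)]
    refine integral_mono ((i2.inner_const g).sub (i1.inner_const g)) hn fun p => ?_
    change ⟪φ p.2, g⟫ - ⟪φ p.1, g⟫ ≤ ‖φ p.1 - φ p.2‖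
    rw [← inner_sub_left, norm_sub_rev]
    exact (real_inner_le_norm _ _).trans (mul_le_of_le_one_right (norm_nonneg _) hg)
  have hprod : μS.prod μT ∈ Couplings μS μT := by
    refine ⟨inferInstance, ?_, ?_⟩
    · simp [Measure.map_fst_prod]
    · simp [Measure.map_snd_prod]
  have hfin : (⨅ γ ∈ Couplings μS μT,
      ∫⁻ p, ENNReal.ofReal ‖φ p.1 - φ p.2‖ ∂γ) ≠ ⊤ := by
    refine ne_top_of_le_ne_top ?_ (iInf₂_le _ hprod)
    rw [← ofReal_integral_eq_lintegral_ofReal (key _ hprod).1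
      (Filter.Eventually.of_forall fun _ => norm_nonneg _)]
    exact ENNReal.ofReal_ne_top
  have hle : ENNReal.ofReal (err μT ℓ h h' - err μS ℓ h h') ≤ ⨅ γ ∈ Couplings μS μT,
      ∫⁻ p, ENNReal.ofReal ‖φ p.1 - φ p.2‖ ∂γ := by
    refine le_iInf₂ fun γ hγ => ?_
    rw [← ofReal_integral_eq_lintegral_ofReal (key _ hγ).1
      (Filter.Eventually.of_forall fun _ => norm_nonneg _)]
    exact ENNReal.ofReal_le_ofReal (key _ hγ).2
  have := (ENNReal.ofReal_le_iff_le_toReal hfin).1 hle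
  unfold W1
  linarith
end
end

section
/- (Deterministic core of Theorem 2.) Let Ω be a measurable space, H a real Hilbert space, φ : Ω → H measurable and Bochner-integrable with respect to probability measures μ_S and μ_T on Ω, and c(x,y) = ‖φ(x) − φ(y)‖_H. Let ℓ be a loss function that is symmetric and satisfies the triangle inequality ℓ(a,c) ≤ ℓ(a,b) + ℓ(b,c), and suppose that for every pair of functions u, v among the hypotheses and the labeling functions f_S, f_T considered below, the map x ↦ ℓ(u(x), v(x)) has the form x ↦ ⟨φ(x), g⟩_H for some g ∈ H with ‖g‖_H ≤ 1. Then for every hypothesis h and every hypothesis h*, ε_T(h, f_T) ≤ ε_S(h, f_S) + W₁(μ_S, μ_T) + ε_S(h*, f_S) + ε_T(h*, f_T). In particular, ε_T(h) ≤ ε_S(h) + W₁(μ_S, μ_T) + λ, where λ = inf_{h*} ( ε_S(h*) + ε_T(h*) ). -/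
open MeasureTheory
open scoped RealInnerProductSpace ENNReal

noncomputable section

/-- Any unit-ball element of the dual tests the difference of the measures below `W1`. -/
theorem integral_inner_le_add_W1
    {Ω H : Type*} [MeasurableSpace Ω]
    [NormedAddCommGroup H] [InnerProductSpace ℝ H] [CompleteSpace H]
    [MeasurableSpace H] [BorelSpace H]
    (μS μT : Measure Ω) [IsProbabilityMeasure μS] [IsProbabilityMeasure μT]
    (φ : Ω → H) (hφ : Measurable φ)
    (hφS : Integrable φ μS) (hφT : Integrable φ μT) (g : H) (hg : ‖g‖ ≤ 1) :
    ∫ x, ⟪φ x, g⟫ ∂μT ≤ ∫ x, ⟪φ x, g⟫ ∂μS + W1 (fun x y => ‖φ x - φ y‖) μS μT := by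
  have hiS : Integrable (fun x => ⟪φ x, g⟫) μS := hφS.inner_const g
  have hiT : Integrable (fun x => ⟪φ x, g⟫) μT := hφT.inner_const g
  have hn : Measurable (fun x => ‖φ x‖ₑ) := (continuous_enorm.measurable).comp hφ
  have hfin : (⨅ γ ∈ Couplings μS μT, ∫⁻ p, ENNReal.ofReal ‖φ p.1 - φ p.2‖ ∂γ) ≠ ∞ := by
    have hmem : μS.prod μT ∈ Couplings μS μT := by
      refine ⟨inferInstance, ?_, ?_⟩
      · simp [Measure.map_fst_prod]
      · simp [Measure.map_snd_prod]
    refine ne_top_of_le_ne_top ?_ (iInf₂_le _ hmem)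
    have hle : ∫⁻ p, ENNReal.ofReal ‖φ p.1 - φ p.2‖ ∂(μS.prod μT)
        ≤ ∫⁻ p, (‖φ p.1‖ₑ + ‖φ p.2‖ₑ) ∂(μS.prod μT) := by
      refine lintegral_mono fun p => ?_
      rw [ofReal_norm]
      exact enorm_sub_le
    refine ne_top_of_le_ne_top ?_ hle
    have hn1 : Measurable (fun p : Ω × Ω => ‖φ p.1‖ₑ) := hn.comp measurable_fst
    rw [lintegral_add_left hn1]
    have e1 : ∫⁻ p, ‖φ p.1‖ₑ ∂(μS.prod μT) = ∫⁻ x, ‖φ x‖ₑ ∂μS := by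
      have := (lintegral_map hn measurable_fst (μ := μS.prod μT)).symm
      rw [this, hmem.2.1]
    have e2 : ∫⁻ p, ‖φ p.2‖ₑ ∂(μS.prod μT) = ∫⁻ x, ‖φ x‖ₑ ∂μT := by
      have := (lintegral_map hn measurable_snd (μ := μS.prod μT)).symm
      rw [this, hmem.2.2]
    rw [e1, e2]
    exact ENNReal.add_ne_top.2 ⟨hφS.2.ne, hφT.2.ne⟩
  rw [← sub_le_iff_le_add']
  unfold W1
  refine (ENNReal.ofReal_le_iff_le_toReal hfin).1 ?_
  refine le_iInf₂ fun γ hγ => ?_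
  obtain ⟨_, h1, h2⟩ := hγ
  have e1 : ∫ x, ⟪φ x, g⟫ ∂μS = ∫ p, ⟪φ p.1, g⟫ ∂γ := by
    rw [← h1] at hiS ⊢
    exact integral_map measurable_fst.aemeasurable hiS.1
  have e2 : ∫ x, ⟪φ x, g⟫ ∂μT = ∫ p, ⟪φ p.2, g⟫ ∂γ := by
    rw [← h2] at hiT ⊢
    exact integral_map measurable_snd.aemeasurable hiT.1
  have i1 : Integrable (fun p : Ω × Ω => ⟪φ p.1, g⟫) γ := by
    rw [← h1] at hiS
    exact hiS.comp_measurable measurable_fst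
  have i2 : Integrable (fun p : Ω × Ω => ⟪φ p.2, g⟫) γ := by
    rw [← h2] at hiT
    exact hiT.comp_measurable measurable_snd
  rw [e1, e2, ← integral_sub i2 i1]
  refine (ENNReal.ofReal_le_ofReal (le_abs_self _)).trans ?_
  rw [← Real.norm_eq_abs, ofReal_norm]
  refine (enorm_integral_le_lintegral_enorm _).trans (lintegral_mono fun p => ?_)
  rw [← ofReal_norm]
  refine ENNReal.ofReal_le_ofReal ?_
  rw [← inner_sub_left, norm_sub_rev (φ p.1)]
  exact (norm_inner_le_norm _ _).trans (mul_le_of_le_one_right (norm_nonneg _) hg)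

/-- deterministic core of Theorem 2: with a symmetric loss satisfying the triangle
inequality, whose relevant instantiations are all of the form `x ↦ ⟪φ(x), g⟫` with `‖g‖ ≤ 1`,
one has `ε_T(h, f_T) ≤ ε_S(h, f_S) + W₁(μ_S,μ_T) + ε_S(h*, f_S) + ε_T(h*, f_T)` for all hypotheses
`h, h*`, and in particular `ε_T(h) ≤ ε_S(h) + W₁(μ_S,μ_T) + λ` with
`λ = inf_{h*}(ε_S(h*) + ε_T(h*))`. -/
theorem target_err_le_source_err_add_W1_add_lambda
    {Ω H : Type*} [MeasurableSpace Ω]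
    [NormedAddCommGroup H] [InnerProductSpace ℝ H] [CompleteSpace H]
    [MeasurableSpace H] [BorelSpace H]
    (μS μT : Measure Ω) [IsProbabilityMeasure μS] [IsProbabilityMeasure μT]
    (φ : Ω → H) (hφ : Measurable φ)
    (hφS : Integrable φ μS) (hφT : Integrable φ μT)
    (ℓ : ℝ → ℝ → ℝ)
    (hsym : ∀ a b, ℓ a b = ℓ b a)
    (htri : ∀ a b c, ℓ a c ≤ ℓ a b + ℓ b c)
    (𝓗 : Set (Ω → ℝ)) (fS fT : Ω → ℝ)
    (hrepr : ∀ u v : Ω → ℝ,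
      (u ∈ 𝓗 ∨ u = fS ∨ u = fT) → (v ∈ 𝓗 ∨ v = fS ∨ v = fT) →
      ∃ g : H, ‖g‖ ≤ 1 ∧ ∀ x, ℓ (u x) (v x) = ⟪φ x, g⟫) :
    (∀ h ∈ 𝓗, ∀ hstar ∈ 𝓗,
      err μT ℓ h fT ≤ err μS ℓ h fS + W1 (fun x y => ‖φ x - φ y‖) μS μT
        + err μS ℓ hstar fS + err μT ℓ hstar fT) ∧
    (∀ h ∈ 𝓗,
      err μT ℓ h fT ≤ err μS ℓ h fS + W1 (fun x y => ‖φ x - φ y‖) μS μT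
        + sInf {r : ℝ | ∃ hstar ∈ 𝓗, r = err μS ℓ hstar fS + err μT ℓ hstar fT}) := by
  have hint : ∀ (μ : Measure Ω), Integrable φ μ → ∀ u v : Ω → ℝ,
      (u ∈ 𝓗 ∨ u = fS ∨ u = fT) → (v ∈ 𝓗 ∨ v = fS ∨ v = fT) →
      Integrable (fun x => ℓ (u x) (v x)) μ := by
    intro μ hμ u v hu hv
    obtain ⟨g, -, hg⟩ := hrepr u v hu hv
    simp only [hg]
    exact hμ.inner_const g
  have main : ∀ h ∈ 𝓗, ∀ hstar ∈ 𝓗,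
      err μT ℓ h fT ≤ err μS ℓ h fS + W1 (fun x y => ‖φ x - φ y‖) μS μT
        + err μS ℓ hstar fS + err μT ℓ hstar fT := by
    intro h hh k hk
    have a1 : err μT ℓ h fT ≤ err μT ℓ h k + err μT ℓ k fT := by
      unfold err
      have i1 := hint μT hφT h k (.inl hh) (.inl hk)
      have i2 := hint μT hφT k fT (.inl hk) (.inr (.inr rfl))
      rw [← integral_add i1 i2]
      exact integral_mono (hint μT hφT h fT (.inl hh) (.inr (.inr rfl))) (i1.add i2)
        fun x => htri _ _ _
    have a2 : err μS ℓ h k ≤ err μS ℓ h fS + err μS ℓ k fS := by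
      unfold err
      have i1 := hint μS hφS h fS (.inl hh) (.inr (.inl rfl))
      have i2 := hint μS hφS k fS (.inl hk) (.inr (.inl rfl))
      rw [← integral_add i1 i2]
      refine integral_mono (hint μS hφS h k (.inl hh) (.inl hk)) (i1.add i2) fun x => ?_
      have := htri (h x) (fS x) (k x)
      rw [hsym (fS x)] at this
      exact this
    have a3 : err μT ℓ h k ≤ err μS ℓ h k + W1 (fun x y => ‖φ x - φ y‖) μS μT := by
      obtain ⟨g, hg, hgx⟩ := hrepr h k (.inl hh) (.inl hk)
      unfold err
      simp only [hgx]
      exact integral_inner_le_add_W1 μS μT φ hφ hφS hφT g hg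
    linarith
  refine ⟨main, fun h hh => ?_⟩
  rw [← sub_le_iff_le_add']
  refine le_csInf ⟨_, h, hh, rfl⟩ ?_
  rintro r ⟨k, hk, rfl⟩
  have := main h hh k hk
  linarith
end
end

section
/- (Key step of Theorem 3.) Under the assumptions of the deterministic core of Theorem 2 (feature map φ with cost c(x,y) = ‖φ(x) − φ(y)‖_H, symmetric loss ℓ obeying the triangle inequality, all relevant losses of the form ⟨φ(x), g⟩_H with ‖g‖_H ≤ 1), define for α ∈ [0,1] the combined error ε_α(h) = α ε_T(h) + (1 − α) ε_S(h). Then for every hypothesis h, |ε_α(h) − ε_T(h)| ≤ (1 − α) · ( W₁(μ_S, μ_T) + λ ), where λ = inf_{h*}( ε_S(h*) + ε_T(h*) ). -/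
open MeasureTheory
open scoped RealInnerProductSpace ENNReal

noncomputable section

/-- Integrating a bounded linear functional of the feature map against two measures: the
difference is at most the Wasserstein distance. -/
theorem integral_inner_sub_le_W1 {Ω H : Type*} [MeasurableSpace Ω]
    [NormedAddCommGroup H] [InnerProductSpace ℝ H]
    (μ ν : Measure Ω) [IsProbabilityMeasure μ] [IsProbabilityMeasure ν]
    (φ : Ω → H) (hμ : Integrable φ μ) (hν : Integrable φ ν) (g : H) (hg : ‖g‖ ≤ 1) :
    |(∫ x, ⟪φ x, g⟫ ∂μ) - ∫ x, ⟪φ x, g⟫ ∂ν| ≤ W1 (fun x y => ‖φ x - φ y‖) μ ν := by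
  have key : ∀ γ ∈ Couplings μ ν, Integrable (fun p : Ω × Ω => φ p.1 - φ p.2) γ ∧
      |(∫ x, ⟪φ x, g⟫ ∂μ) - ∫ x, ⟪φ x, g⟫ ∂ν| ≤ ∫ p, ‖φ p.1 - φ p.2‖ ∂γ := by
    rintro γ ⟨hγ, h1, h2⟩
    have i1 : Integrable (fun p : Ω × Ω => φ p.1) γ := by
      rw [← h1] at hμ
      exact hμ.comp_measurable measurable_fst
    have i2 : Integrable (fun p : Ω × Ω => φ p.2) γ := by
      rw [← h2] at hν
      exact hν.comp_measurable measurable_snd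
    have e1 : ∫ x, ⟪φ x, g⟫ ∂μ = ∫ p, ⟪φ p.1, g⟫ ∂γ := by
      have hm : AEStronglyMeasurable (fun x => ⟪φ x, g⟫) (γ.map Prod.fst) := by
        rw [h1]; exact (hμ.inner_const g).aestronglyMeasurable
      rw [← integral_map measurable_fst.aemeasurable hm, h1]
    have e2 : ∫ x, ⟪φ x, g⟫ ∂ν = ∫ p, ⟪φ p.2, g⟫ ∂γ := by
      have hm : AEStronglyMeasurable (fun x => ⟪φ x, g⟫) (γ.map Prod.snd) := by
        rw [h2]; exact (hν.inner_const g).aestronglyMeasurable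
      rw [← integral_map measurable_snd.aemeasurable hm, h2]
    refine ⟨i1.sub i2, ?_⟩
    rw [e1, e2, ← integral_sub (i1.inner_const g) (i2.inner_const g), ← Real.norm_eq_abs]
    refine norm_integral_le_of_norm_le (i1.sub i2).norm (Filter.Eventually.of_forall fun p => ?_)
    rw [← inner_sub_left]
    refine (norm_inner_le_norm _ _).trans ?_
    exact mul_le_of_le_one_right (norm_nonneg _) hg
  have key2 : ∀ γ ∈ Couplings μ ν, ∫⁻ p, ENNReal.ofReal ‖φ p.1 - φ p.2‖ ∂γ =
      ENNReal.ofReal (∫ p, ‖φ p.1 - φ p.2‖ ∂γ) := by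
    intro γ hγ
    rw [ofReal_integral_eq_lintegral_ofReal (key γ hγ).1.norm
      (Filter.Eventually.of_forall fun p => norm_nonneg _)]
  have hprod : μ.prod ν ∈ Couplings μ ν :=
    ⟨inferInstance, by simp [Measure.map_fst_prod], by simp [Measure.map_snd_prod]⟩
  unfold W1
  refine (ENNReal.ofReal_le_iff_le_toReal ?_).1 ?_
  · refine ne_top_of_le_ne_top ?_ (iInf₂_le (μ.prod ν) hprod)
    rw [key2 _ hprod]
    exact ENNReal.ofReal_ne_top
  · refine le_iInf₂ fun γ hγ => ?_
    rw [key2 γ hγ]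
    exact ENNReal.ofReal_le_ofReal (key γ hγ).2

/-- key step of Theorem 3: under the assumptions of the deterministic core of
Theorem 2, for the combined error `ε_α(h) = α ε_T(h) + (1-α) ε_S(h)` with `α ∈ [0,1]`, every
hypothesis `h` satisfies `|ε_α(h) - ε_T(h)| ≤ (1-α)(W₁(μ_S,μ_T) + λ)`, where
`λ = inf_{h*}(ε_S(h*) + ε_T(h*))`. -/
theorem abs_combined_err_sub_target_err_le
    {Ω H : Type*} [MeasurableSpace Ω]
    [NormedAddCommGroup H] [InnerProductSpace ℝ H] [CompleteSpace H]
    [MeasurableSpace H] [BorelSpace H]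
    (μS μT : Measure Ω) [IsProbabilityMeasure μS] [IsProbabilityMeasure μT]
    (φ : Ω → H) (hφ : Measurable φ)
    (hφS : Integrable φ μS) (hφT : Integrable φ μT)
    (ℓ : ℝ → ℝ → ℝ)
    (hsym : ∀ a b, ℓ a b = ℓ b a)
    (htri : ∀ a b c, ℓ a c ≤ ℓ a b + ℓ b c)
    (𝓗 : Set (Ω → ℝ)) (fS fT : Ω → ℝ)
    (hrepr : ∀ u v : Ω → ℝ,
      (u ∈ 𝓗 ∨ u = fS ∨ u = fT) → (v ∈ 𝓗 ∨ v = fS ∨ v = fT) →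
      ∃ g : H, ‖g‖ ≤ 1 ∧ ∀ x, ℓ (u x) (v x) = ⟪φ x, g⟫)
    (α : ℝ) (hα : α ∈ Set.Icc (0 : ℝ) 1) :
    ∀ h ∈ 𝓗,
      |(α * err μT ℓ h fT + (1 - α) * err μS ℓ h fS) - err μT ℓ h fT|
        ≤ (1 - α) * (W1 (fun x y => ‖φ x - φ y‖) μS μT
            + sInf {r : ℝ | ∃ hstar ∈ 𝓗, r = err μS ℓ hstar fS + err μT ℓ hstar fT}) := by
  intro h hh
  have hint : ∀ (μ : Measure Ω), Integrable φ μ → ∀ u v : Ω → ℝ,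
      (u ∈ 𝓗 ∨ u = fS ∨ u = fT) → (v ∈ 𝓗 ∨ v = fS ∨ v = fT) →
      Integrable (fun x => ℓ (u x) (v x)) μ := by
    intro μ hμ u v hu hv
    obtain ⟨g, -, hg⟩ := hrepr u v hu hv
    simp only [hg]
    exact hμ.inner_const g
  have tri : ∀ (μ : Measure Ω), Integrable φ μ → ∀ u v w : Ω → ℝ,
      (u ∈ 𝓗 ∨ u = fS ∨ u = fT) → (v ∈ 𝓗 ∨ v = fS ∨ v = fT) →
      (w ∈ 𝓗 ∨ w = fS ∨ w = fT) → err μ ℓ u w ≤ err μ ℓ u v + err μ ℓ v w := by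
    intro μ hμ u v w hu hv hw
    unfold err
    rw [← integral_add (hint μ hμ u v hu hv) (hint μ hμ v w hv hw)]
    exact integral_mono (hint μ hμ u w hu hw)
      ((hint μ hμ u v hu hv).add (hint μ hμ v w hv hw)) fun x => htri _ _ _
  have symm : ∀ (μ : Measure Ω) (u v : Ω → ℝ), err μ ℓ u v = err μ ℓ v u := by
    intro μ u v
    unfold err
    simp only [hsym]
  have main : |err μS ℓ h fS - err μT ℓ h fT| ≤ W1 (fun x y => ‖φ x - φ y‖) μS μT
      + sInf {r : ℝ | ∃ hstar ∈ 𝓗, r = err μS ℓ hstar fS + err μT ℓ hstar fT} := by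
    rw [← sub_le_iff_le_add']
    refine le_csInf ⟨_, h, hh, rfl⟩ ?_
    rintro r ⟨k, hk, rfl⟩
    have hW : |err μS ℓ h k - err μT ℓ h k| ≤ W1 (fun x y => ‖φ x - φ y‖) μS μT := by
      obtain ⟨g, hg1, hg⟩ := hrepr h k (Or.inl hh) (Or.inl hk)
      unfold err
      simp only [hg]
      exact integral_inner_sub_le_W1 μS μT φ hφS hφT g hg1
    have hS : fS ∈ 𝓗 ∨ fS = fS ∨ fS = fT := Or.inr (Or.inl rfl)
    have hT : fT ∈ 𝓗 ∨ fT = fS ∨ fT = fT := Or.inr (Or.inr rfl)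
    have t1 := tri μS hφS h k fS (Or.inl hh) (Or.inl hk) hS
    have t2 := tri μS hφS h fS k (Or.inl hh) hS (Or.inl hk)
    have t3 := tri μT hφT h k fT (Or.inl hh) (Or.inl hk) hT
    have t4 := tri μT hφT h fT k (Or.inl hh) hT (Or.inl hk)
    rw [symm μS fS k] at t2
    rw [symm μT fT k] at t4
    rw [sub_le_iff_le_add']
    rw [abs_le] at hW ⊢
    constructor <;> linarith [hW.1, hW.2]
  have e : (α * err μT ℓ h fT + (1 - α) * err μS ℓ h fS) - err μT ℓ h fT
      = (1 - α) * (err μS ℓ h fS - err μT ℓ h fT) := by ring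
  have h0 : 0 ≤ 1 - α := sub_nonneg.2 hα.2
  rw [e, abs_mul, abs_of_nonneg h0]
  exact mul_le_mul_of_nonneg_left main h0
end
end

section
/- (Key step of Theorem 4, multi-source.) Under the assumptions of the deterministic core of Theorem 2 applied to each pair of domains (feature map φ with cost c(x,y) = ‖φ(x) − φ(y)‖_H, symmetric loss ℓ obeying the triangle inequality, all relevant losses of the form ⟨φ(x), g⟩_H with ‖g‖_H ≤ 1), let μ_{S_1}, …, μ_{S_N} be N source probability measures with labeling functions f_1,…,f_N, let μ_T be the target measure with labeling function f_T, and let α_1,…,α_N ≥ 0 satisfy ∑_{j=1}^N α_j = 1. Define the weighted multi-source error ε_𝛂(h) = ∑_{j=1}^N α_j ε_{S_j}(h). Then for every hypothesis h, |ε_𝛂(h) − ε_T(h)| ≤ ∑_{j=1}^N α_j ( W₁(μ_{S_j}, μ_T) + λ_j ), where λ_j = inf_{h*}( ε_{S_j}(h*) + ε_T(h*) ). -/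
open MeasureTheory
open scoped RealInnerProductSpace ENNReal

noncomputable section

/-- Deviation of expectations of `⟪φ, g⟫`, `‖g‖ ≤ 1`, is bounded by `W₁`. -/
theorem abs_sub_le_W1_aux {Ω H : Type*} [MeasurableSpace Ω]
    [NormedAddCommGroup H] [InnerProductSpace ℝ H]
    [MeasurableSpace H] [BorelSpace H]
    (μ ν : Measure Ω) [IsProbabilityMeasure μ] [IsProbabilityMeasure ν]
    (φ : Ω → H) (hφ : Measurable φ) (hμ : Integrable φ μ) (hν : Integrable φ ν)
    (g : H) (hg : ‖g‖ ≤ 1) :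
    |(∫ x, ⟪φ x, g⟫ ∂μ) - ∫ x, ⟪φ x, g⟫ ∂ν| ≤ W1 (fun x y => ‖φ x - φ y‖) μ ν := by
  unfold W1
  have hfin : (⨅ γ ∈ Couplings μ ν, ∫⁻ p, ENNReal.ofReal (‖φ p.1 - φ p.2‖) ∂γ) ≠ ∞ := by
    have hmem : μ.prod ν ∈ Couplings μ ν := by
      refine ⟨inferInstance, ?_, ?_⟩
      · simp
      · simp
    refine ne_top_of_le_ne_top ?_ (iInf₂_le (μ.prod ν) hmem)
    have hle : ∫⁻ p, ENNReal.ofReal (‖φ p.1 - φ p.2‖) ∂(μ.prod ν)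
        ≤ ∫⁻ p, (‖φ p.1‖ₑ + ‖φ p.2‖ₑ) ∂(μ.prod ν) := by
      refine lintegral_mono fun p => ?_
      rw [ofReal_norm]
      exact enorm_sub_le
    refine ne_top_of_le_ne_top ?_ hle
    have hm : Measurable fun x => ‖φ x‖ₑ := continuous_enorm.measurable.comp hφ
    have hm1 : Measurable fun p : Ω × Ω => ‖φ p.1‖ₑ := hm.comp measurable_fst
    rw [lintegral_add_left hm1]
    have h1 : ∫⁻ p, ‖φ p.1‖ₑ ∂(μ.prod ν) = ∫⁻ x, ‖φ x‖ₑ ∂μ := by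
      have := lintegral_map (μ := μ.prod ν) hm measurable_fst
      rw [← this]; simp
    have h2 : ∫⁻ p, ‖φ p.2‖ₑ ∂(μ.prod ν) = ∫⁻ x, ‖φ x‖ₑ ∂ν := by
      have := lintegral_map (μ := μ.prod ν) hm measurable_snd
      rw [← this]; simp
    rw [h1, h2]
    exact ENNReal.add_ne_top.2 ⟨hμ.2.ne, hν.2.ne⟩
  rw [← ENNReal.ofReal_le_iff_le_toReal hfin]
  refine le_iInf₂ fun γ hγ => ?_
  obtain ⟨hp, rfl, rfl⟩ := hγ
  have i1 := hμ.inner_const (𝕜 := ℝ) g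
  have i2 := hν.inner_const (𝕜 := ℝ) g
  have j1 : Integrable (fun p : Ω × Ω => ⟪φ p.1, g⟫) γ := i1.comp_measurable measurable_fst
  have j2 : Integrable (fun p : Ω × Ω => ⟪φ p.2, g⟫) γ := i2.comp_measurable measurable_snd
  rw [integral_map measurable_fst.aemeasurable i1.1,
    integral_map measurable_snd.aemeasurable i2.1,
    ← integral_sub j1 j2,
    ← Real.norm_eq_abs, ofReal_norm]
  refine (enorm_integral_le_lintegral_enorm _).trans (lintegral_mono fun p => ?_)
  rw [← ofReal_norm]
  refine ENNReal.ofReal_le_ofReal ?_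
  rw [← inner_sub_left]
  calc ‖⟪φ p.1 - φ p.2, g⟫‖ ≤ ‖φ p.1 - φ p.2‖ * ‖g‖ := norm_inner_le_norm _ _
    _ ≤ ‖φ p.1 - φ p.2‖ := mul_le_of_le_one_right (norm_nonneg _) hg

/-- key step of Theorem 4, multi-source: for `N` source domains with weights
`α_j ≥ 0`, `∑ α_j = 1`, and weighted multi-source error `ε_𝛂(h) = ∑_j α_j ε_{S_j}(h)`, every
hypothesis `h` satisfies `|ε_𝛂(h) - ε_T(h)| ≤ ∑_j α_j (W₁(μ_{S_j}, μ_T) + λ_j)`, where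
`λ_j = inf_{h*}(ε_{S_j}(h*) + ε_T(h*))`. -/
theorem abs_weighted_multisource_err_sub_target_err_le
    {Ω H : Type*} [MeasurableSpace Ω]
    [NormedAddCommGroup H] [InnerProductSpace ℝ H] [CompleteSpace H]
    [MeasurableSpace H] [BorelSpace H]
    (N : ℕ) (μSj : Fin N → Measure Ω) [∀ j, IsProbabilityMeasure (μSj j)]
    (μT : Measure Ω) [IsProbabilityMeasure μT]
    (φ : Ω → H) (hφ : Measurable φ)
    (hφS : ∀ j, Integrable φ (μSj j)) (hφT : Integrable φ μT)
    (ℓ : ℝ → ℝ → ℝ)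
    (hsym : ∀ a b, ℓ a b = ℓ b a)
    (htri : ∀ a b c, ℓ a c ≤ ℓ a b + ℓ b c)
    (𝓗 : Set (Ω → ℝ)) (f : Fin N → Ω → ℝ) (fT : Ω → ℝ)
    (hrepr : ∀ u v : Ω → ℝ,
      (u ∈ 𝓗 ∨ (∃ j, u = f j) ∨ u = fT) → (v ∈ 𝓗 ∨ (∃ j, v = f j) ∨ v = fT) →
      ∃ g : H, ‖g‖ ≤ 1 ∧ ∀ x, ℓ (u x) (v x) = ⟪φ x, g⟫)
    (αw : Fin N → ℝ) (hαw : ∀ j, 0 ≤ αw j) (hαsum : ∑ j, αw j = 1) :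
    ∀ h ∈ 𝓗,
      |(∑ j, αw j * err (μSj j) ℓ h (f j)) - err μT ℓ h fT|
        ≤ ∑ j, αw j * (W1 (fun x y => ‖φ x - φ y‖) (μSj j) μT
            + sInf {r : ℝ | ∃ hstar ∈ 𝓗,
                r = err (μSj j) ℓ hstar (f j) + err μT ℓ hstar fT}) := by
  intro h hh
  have hint : ∀ (u v : Ω → ℝ) (μ : Measure Ω), Integrable φ μ →
      (u ∈ 𝓗 ∨ (∃ j, u = f j) ∨ u = fT) → (v ∈ 𝓗 ∨ (∃ j, v = f j) ∨ v = fT) →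
      Integrable (fun x => ℓ (u x) (v x)) μ := by
    intro u v μ hμ hu hv
    obtain ⟨g, -, hg⟩ := hrepr u v hu hv
    simp only [hg]
    exact hμ.inner_const (𝕜 := ℝ) g
  have htriE : ∀ (u v w : Ω → ℝ) (μ : Measure Ω), Integrable φ μ →
      (u ∈ 𝓗 ∨ (∃ j, u = f j) ∨ u = fT) → (v ∈ 𝓗 ∨ (∃ j, v = f j) ∨ v = fT) →
      (w ∈ 𝓗 ∨ (∃ j, w = f j) ∨ w = fT) →
      err μ ℓ u w ≤ err μ ℓ u v + err μ ℓ v w := by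
    intro u v w μ hμ hu hv hw
    unfold err
    rw [← integral_add (hint u v μ hμ hu hv) (hint v w μ hμ hv hw)]
    exact integral_mono (hint u w μ hμ hu hw)
      ((hint u v μ hμ hu hv).add (hint v w μ hμ hv hw)) fun x => htri _ _ _
  have hsymE : ∀ (u v : Ω → ℝ) (μ : Measure Ω), err μ ℓ u v = err μ ℓ v u := by
    intro u v μ
    unfold err
    congr 1
    funext x
    exact hsym _ _
  have key : ∀ j, |err (μSj j) ℓ h (f j) - err μT ℓ h fT|
      ≤ W1 (fun x y => ‖φ x - φ y‖) (μSj j) μT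
            + sInf {r : ℝ | ∃ hstar ∈ 𝓗,
                r = err (μSj j) ℓ hstar (f j) + err μT ℓ hstar fT} := by
    intro j
    rw [← sub_le_iff_le_add']
    refine le_csInf ⟨_, h, hh, rfl⟩ ?_
    rintro r ⟨k, hk, rfl⟩
    have hW : |err (μSj j) ℓ h k - err μT ℓ h k|
        ≤ W1 (fun x y => ‖φ x - φ y‖) (μSj j) μT := by
      obtain ⟨g, hg1, hg⟩ := hrepr h k (Or.inl hh) (Or.inl hk)
      unfold err
      simp only [hg]
      exact abs_sub_le_W1_aux _ _ φ hφ (hφS j) hφT g hg1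
    have cj : f j ∈ 𝓗 ∨ (∃ i, f j = f i) ∨ f j = fT := Or.inr (Or.inl ⟨j, rfl⟩)
    have cT : fT ∈ 𝓗 ∨ (∃ i, fT = f i) ∨ fT = fT := Or.inr (Or.inr rfl)
    have a1 := htriE h k (f j) _ (hφS j) (Or.inl hh) (Or.inl hk) cj
    have a2 := htriE h fT k _ hφT (Or.inl hh) cT (Or.inl hk)
    have a3 := htriE h k fT _ hφT (Or.inl hh) (Or.inl hk) cT
    have a4 := htriE h (f j) k _ (hφS j) (Or.inl hh) cj (Or.inl hk)
    rw [hsymE fT k] at a2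
    rw [hsymE (f j) k] at a4
    rw [sub_le_iff_le_add']
    rw [abs_le] at hW ⊢
    constructor <;> linarith [hW.1, hW.2]
  have heq : (∑ j, αw j * err (μSj j) ℓ h (f j)) - err μT ℓ h fT
      = ∑ j, αw j * (err (μSj j) ℓ h (f j) - err μT ℓ h fT) := by
    simp only [mul_sub, Finset.sum_sub_distrib, ← Finset.sum_mul, hαsum, one_mul]
  rw [heq]
  refine (Finset.abs_sum_le_sum_abs _ _).trans (Finset.sum_le_sum fun j _ => ?_)
  rw [abs_mul, abs_of_nonneg (hαw j)]
  exact mul_le_mul_of_nonneg_left (key j) (hαw j)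
end
end
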